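/- Let d ≥ 1 and let μ be a translation invariant measure on the Borel σ-algebra of ℝ^d that is not equal to the Lebesgue measure λ but for which there exists a compact set K with 0 < μ(K) = λ(K) < ∞. Then μ is not a Hausdorff measure: for every right-continuous increasing function h : [0,∞) → [0,∞] with h(0) = 0, μ does not coincide on the Borel sets with the Hausdorff measure corresponding to h. -/

import Mathlib

open MeasureTheory Set ENNReal

/-- A measure on `ℝ^d` is translation invariant if the measure of every translate of a
Borel set equals the measure of the set. -/
def TranslationInvariant {d : ℕ} (μ : Measure (EuclideanSpace ℝ (Fin d))) : Prop :=
  ∀ (A : Set (EuclideanSpace ℝ (Fin d))) (x : EuclideanSpace ℝ (Fin d)),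
    MeasurableSet A → μ ((fun y => y + x) '' A) = μ A

open Filter Topology Metric

/-- The open unit cube is covered, for every scale `ε > 0`, by finitely many sets of diameter at
most `ε`, whose number is controlled by the power `ε ^ (-d)`. -/
theorem exists_cover_unitCube (d : ℕ) (ε : ℝ) (hε : 0 < ε) :
    ∃ (n : ℕ) (t : (Fin d → Fin n) → Set (EuclideanSpace ℝ (Fin d))),
      (n : ℝ) * ε ≤ d + ε ∧ (∀ k, ediam (t k) ≤ ENNReal.ofReal ε) ∧
        {y : EuclideanSpace ℝ (Fin d) | ∀ j, y j ∈ Ioo (0 : ℝ) 1} ⊆ ⋃ k, t k := by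
  rcases Nat.eq_zero_or_pos d with rfl | hd
  · refine ⟨0, fun _ => univ, by simpa using hε.le, fun k => ?_, fun y _ => ?_⟩
    · simp [ediam_subsingleton subsingleton_univ]
    · exact mem_iUnion.2 ⟨finZeroElim, mem_univ _⟩
  have hd' : (0 : ℝ) < d := by exact_mod_cast hd
  set n := ⌈(d : ℝ) / ε⌉₊
  have hn : (d : ℝ) / ε ≤ n := Nat.le_ceil _
  have hn0 : (0 : ℝ) < n := (div_pos hd' hε).trans_le hn
  refine ⟨n, fun k => {y | ∀ j, y j ∈ Icc ((k j : ℝ) / n) (((k j : ℝ) + 1) / n)}, ?_, ?_, ?_⟩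
  · have := (Nat.ceil_lt_add_one (div_pos hd' hε).le).le
    calc (n : ℝ) * ε ≤ (d / ε + 1) * ε := by gcongr
      _ = d + ε := by field_simp
  · intro k
    refine ediam_le_of_forall_dist_le fun x hx y hy => ?_
    have hcoord : ∀ i, dist (x i) (y i) ^ 2 ≤ (1 / n : ℝ) ^ 2 := fun i => by
      have := Real.dist_le_of_mem_Icc (hx i) (hy i)
      gcongr
      calc dist (x i) (y i) ≤ _ := this
        _ = 1 / n := by ring
    rw [EuclideanSpace.dist_eq]
    apply Real.sqrt_le_iff.2 ⟨hε.le, ?_⟩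
    calc ∑ i, dist (x i) (y i) ^ 2 ≤ ∑ _i : Fin d, (1 / n : ℝ) ^ 2 :=
          Finset.sum_le_sum fun i _ => hcoord i
      _ = d * (1 / n : ℝ) ^ 2 := by simp
      _ ≤ (d : ℝ) ^ 2 * (1 / n : ℝ) ^ 2 := by
          gcongr
          exact_mod_cast Nat.le_self_pow two_ne_zero d
      _ = (d / n : ℝ) ^ 2 := by ring
      _ ≤ ε ^ 2 := by
          gcongr
          rw [div_le_iff₀ hn0, mul_comm]
          exact (div_le_iff₀ hε).1 hn
  · intro y hy
    have hlt : ∀ j, ⌊y j * n⌋₊ < n := fun j => by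
      rw [Nat.floor_lt (mul_nonneg (hy j).1.le hn0.le)]
      nlinarith [(hy j).2]
    refine mem_iUnion.2 ⟨fun j => ⟨⌊y j * n⌋₊, hlt j⟩, fun j => ⟨?_, ?_⟩⟩
    · rw [div_le_iff₀ hn0]
      exact Nat.floor_le (mul_nonneg (hy j).1.le hn0.le)
    · rw [le_div_iff₀ hn0]
      exact (Nat.lt_floor_add_one _).le

/-- If the gauge `h` is frequently at most `C * x ^ d` near `0`, then the corresponding Hausdorff
measure of the open unit cube is finite. -/
theorem mkMetric_unitCube_lt_top (d : ℕ) (h : ℝ≥0∞ → ℝ≥0∞) (hmono : Monotone h)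
    (C : ℝ≥0∞) (hC : C ≠ ∞)
    (hfreq : ∃ᶠ x in 𝓝[>] (0 : ℝ≥0∞), h x ≤ C * x ^ d) :
    Measure.mkMetric h {y : EuclideanSpace ℝ (Fin d) | ∀ j, y j ∈ Ioo (0 : ℝ) 1} < ∞ := by
  set l : Filter ℝ≥0∞ := 𝓝[>] 0 ⊓ 𝓟 {x | h x ≤ C * x ^ d}
  have : l.NeBot := frequently_mem_iff_neBot.1 hfreq
  have hl0 : l ≤ 𝓝[>] 0 := inf_le_left
  have hlt : ∀ᶠ x in l, x < 1 :=
    (hl0.trans nhdsWithin_le_nhds) (Iio_mem_nhds zero_lt_one)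
  have hgt : ∀ᶠ x in l, 0 < x := hl0 self_mem_nhdsWithin
  have hle : ∀ᶠ x in l, h x ≤ C * x ^ d := mem_inf_of_right (mem_principal_self _)
  have hcover : ∀ x : ℝ≥0∞, ∃ (n : ℕ) (t : (Fin d → Fin n) → Set (EuclideanSpace ℝ (Fin d))),
      0 < x → x < 1 → (n : ℝ≥0∞) * x ≤ d + 1 ∧ (∀ k, ediam (t k) ≤ x) ∧
        {y : EuclideanSpace ℝ (Fin d) | ∀ j, y j ∈ Ioo (0 : ℝ) 1} ⊆ ⋃ k, t k := by
    intro x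
    by_cases hx : 0 < x ∧ x < 1
    · have hxt : x ≠ ∞ := (hx.2.trans one_lt_top).ne
      have hr1 : x.toReal ≤ 1 := by
        simpa using ENNReal.toReal_mono one_ne_top hx.2.le
      obtain ⟨n, t, hn, hdiam, hsub⟩ :=
        exists_cover_unitCube d x.toReal (ENNReal.toReal_pos hx.1.ne' hxt)
      refine ⟨n, t, fun _ _ => ⟨?_, fun k => ?_, hsub⟩⟩
      · rw [← ENNReal.toReal_le_toReal (by finiteness) (by finiteness),
          ENNReal.toReal_add (by finiteness) (by finiteness)]
        simpa using hn.trans (by gcongr)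
      · simpa [ENNReal.ofReal_toReal hxt] using hdiam k
    · exact ⟨0, fun _ => ∅, fun h0 h1 => absurd ⟨h0, h1⟩ hx⟩
  choose n t hnt using hcover
  have key := Measure.mkMetric_le_liminf_sum
    {y : EuclideanSpace ℝ (Fin d) | ∀ j, y j ∈ Ioo (0 : ℝ) 1} (l := l) (fun x => x)
    (hl0.trans nhdsWithin_le_nhds) t
    (by filter_upwards [hgt, hlt] with x h0 h1 using (hnt x h0 h1).2.1)
    (by filter_upwards [hgt, hlt] with x h0 h1 using (hnt x h0 h1).2.2) h
  have hbound : ∀ᶠ x in l, ∑ k, h (ediam (t x k)) ≤ C * ((d : ℝ≥0∞) + 1) ^ d := by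
    filter_upwards [hgt, hlt, hle] with x h0 h1 hx
    obtain ⟨hn, hdiam, -⟩ := hnt x h0 h1
    calc ∑ k, h (ediam (t x k)) ≤ ∑ _k : Fin d → Fin (n x), C * x ^ d :=
          Finset.sum_le_sum fun k _ => (hmono (hdiam k)).trans hx
      _ = C * (n x * x) ^ d := by
          simp [mul_pow]
          ring
      _ ≤ C * ((d : ℝ≥0∞) + 1) ^ d := by gcongr
  refine (key.trans (liminf_le_of_frequently_le' hbound.frequently)).trans_lt ?_
  finiteness

theorem TranslationInvariant.isAddLeftInvariant {d : ℕ}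
    {μ : Measure (EuclideanSpace ℝ (Fin d))} (hμ : TranslationInvariant μ) :
    μ.IsAddLeftInvariant := by
  refine ⟨fun g => Measure.ext fun A hA => ?_⟩
  rw [Measure.map_apply (measurable_const_add g) hA, ← hμ A (-g) hA]
  congr 1
  ext y
  simp [add_comm]

/-- A translation invariant measure that is finite on some nonempty open set and agrees with
Lebesgue measure, with a positive finite value, on some set is the Lebesgue measure. -/
theorem TranslationInvariant.eq_volume {d : ℕ}
    {μ : Measure (EuclideanSpace ℝ (Fin d))} (hμ : TranslationInvariant μ)
    {U : Set (EuclideanSpace ℝ (Fin d))} (hU : IsOpen U) (hU' : U.Nonempty) (hUfin : μ U ≠ ∞)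
    {K : Set (EuclideanSpace ℝ (Fin d))} (hpos : 0 < μ K) (heq : μ K = volume K)
    (hfin : volume K < ∞) : μ = volume := by
  have := hμ.isAddLeftInvariant
  have : IsFiniteMeasureOnCompacts μ :=
    ⟨fun _ hL => measure_lt_top_of_isCompact_of_isAddLeftInvariant U hU hU' hUfin hL⟩
  have hsmul := Measure.isAddLeftInvariant_eq_smul μ volume
  set c := Measure.addHaarScalarFactor μ volume
  have hc : (c : ℝ≥0∞) * volume K = 1 * volume K := by
    rw [one_mul, ← heq]
    nth_rewrite 2 [hsmul]
    rw [heq, Measure.smul_apply]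
    rfl
  have hc1 : (c : ℝ≥0∞) = 1 := (ENNReal.mul_left_inj (heq ▸ hpos).ne' hfin.ne).1 hc
  rw [hsmul, ENNReal.coe_eq_one.1 hc1, one_smul]

/-- If for every `C` the gauge `h` is eventually at least `C * x ^ d` near `0`, then a set of
finite Hausdorff measure with respect to `h` is Lebesgue null. -/
theorem volume_eq_zero_of_mkMetric_ne_top (d : ℕ) (h : ℝ≥0∞ → ℝ≥0∞)
    (hev : ∀ C : ℝ≥0∞, C ≠ ∞ → ∀ᶠ x in 𝓝[≥] (0 : ℝ≥0∞), C * x ^ d ≤ h x)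
    {K : Set (EuclideanSpace ℝ (Fin d))} (hK : Measure.mkMetric h K ≠ ∞) : volume K = 0 := by
  have hH : Measure.hausdorffMeasure (d : ℝ) K = 0 := by
    by_contra hne
    obtain ⟨N, hN⟩ : ∃ N : ℕ, Measure.mkMetric h K / Measure.hausdorffMeasure (d : ℝ) K < N :=
      ENNReal.exists_nat_gt (ENNReal.div_ne_top hK hne)
    have hN0 : (N : ℝ≥0∞) ≠ 0 := (bot_le.trans_lt hN).ne'
    have hle : Measure.hausdorffMeasure (d : ℝ) ≤
        (N : ℝ≥0∞)⁻¹ • (Measure.mkMetric h : Measure (EuclideanSpace ℝ (Fin d))) := by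
      refine Measure.mkMetric_mono_smul (ENNReal.inv_ne_top.2 hN0)
        (ENNReal.inv_ne_zero.2 (natCast_ne_top N)) ?_
      filter_upwards [hev N (natCast_ne_top N)] with x hx
      rw [ENNReal.rpow_natCast, Pi.smul_apply, smul_eq_mul]
      rwa [← ENNReal.mul_le_iff_le_inv hN0 (natCast_ne_top N)]
    have hKle := hle K
    rw [Measure.smul_apply, smul_eq_mul, ← ENNReal.mul_le_iff_le_inv hN0 (natCast_ne_top N)] at hKle
    by_cases htop : Measure.hausdorffMeasure (d : ℝ) K = ∞
    · rw [htop, ENNReal.mul_top hN0] at hKle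
      exact hK (top_le_iff.1 hKle)
    · rw [ENNReal.div_lt_iff (Or.inl hne) (Or.inl htop)] at hN
      exact absurd hKle hN.not_ge
  have : (Measure.hausdorffMeasure (d : ℝ) :
      Measure (EuclideanSpace ℝ (Fin d))).IsAddHaarMeasure := by
    simpa using isAddHaarMeasure_hausdorffMeasure (E := EuclideanSpace ℝ (Fin d))
  rw [Measure.isAddLeftInvariant_eq_smul volume (Measure.hausdorffMeasure (d : ℝ))]
  simp [hH]

/-- A translation invariant Borel measure `μ` on `ℝ^d` that is not Lebesgue measure but
agrees with it (with a positive finite value) on some compact set is not a Hausdorff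
measure: for every right-continuous increasing gauge `h` with `h 0 = 0`, `μ` does not
coincide on the Borel sets with the Hausdorff measure corresponding to `h`. -/
theorem not_hausdorff_measure (d : ℕ) (hd : 1 ≤ d)
    (μ : Measure (EuclideanSpace ℝ (Fin d))) (hμ : TranslationInvariant μ)
    (hne : μ ≠ volume) (K : Set (EuclideanSpace ℝ (Fin d))) (hK : IsCompact K)
    (hpos : 0 < μ K) (heq : μ K = volume K) (hfin : volume K < ⊤) :
    ∀ h : ℝ≥0∞ → ℝ≥0∞, h 0 = 0 → Monotone h →
      (∀ x : ℝ≥0∞, ContinuousWithinAt h (Set.Ici x) x) →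
      ¬ (∀ A : Set (EuclideanSpace ℝ (Fin d)), MeasurableSet A →
          μ A = Measure.mkMetric h A) := by
  intro h h0 hmono _ hA
  obtain rfl : μ = Measure.mkMetric h := Measure.ext fun A hAm => hA A hAm
  by_cases hev : ∀ C : ℝ≥0∞, C ≠ ∞ → ∀ᶠ x in 𝓝[≥] (0 : ℝ≥0∞), C * x ^ d ≤ h x
  · exact hpos.ne' (heq.trans (volume_eq_zero_of_mkMetric_ne_top d h hev (heq ▸ hfin.ne)))
  push Not at hev
  obtain ⟨C, hC, hfreq⟩ := hev
  have hfreq' : ∃ᶠ x in 𝓝[>] (0 : ℝ≥0∞), h x ≤ C * x ^ d := by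
    rw [frequently_nhdsWithin_iff] at hfreq ⊢
    refine hfreq.mono fun x hx => ⟨hx.1.le, mem_Ioi.2 (pos_iff_ne_zero.2 ?_)⟩
    rintro rfl
    simp [zero_pow (Nat.one_le_iff_ne_zero.1 hd)] at hx
  refine hne (hμ.eq_volume (U := {y | ∀ j, y j ∈ Ioo (0 : ℝ) 1}) ?_ ?_
    (mkMetric_unitCube_lt_top d h hmono C hC hfreq').ne hpos heq hfin)
  · simp only [ofPred_forall]
    exact isOpen_iInter_of_finite fun j => isOpen_Ioo.preimage (by fun_prop)
  · exact ⟨WithLp.toLp 2 fun _ => 1 / 2, fun j => by norm_num⟩
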